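/- (Mehler's formula) For every ρ ∈ [0,1) and all x, y ∈ ℝ, ∑_{n ≥ 0} (ρⁿ / (2ⁿ n!)) H_n(x) H_n(y) e^{-(x²+y²)/2} = (1−ρ²)^{-1/2} exp( (4xyρ − (1+ρ²)(x²+y²)) / (2(1−ρ²)) ), where H_n is the n-th (physicists') Hermite polynomial H_n(x) = (−1)ⁿ e^{x²} (d/dx)ⁿ e^{-x²}. -/

import Mathlib

/-- The `n`-th physicists' Hermite polynomial, via the Rodrigues formula
`H_n(x) = (−1)ⁿ e^{x²} (d/dx)ⁿ e^{-x²}`. -/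
noncomputable def physHermite (n : ℕ) (x : ℝ) : ℝ :=
  (-1 : ℝ) ^ n * Real.exp (x ^ 2) * iteratedDeriv n (fun y => Real.exp (-(y ^ 2))) x

open MeasureTheory

/-- Generic Hermite-type recurrence. -/
noncomputable def KK {𝕜 : Type*} [CommRing 𝕜] (b z : 𝕜) : ℕ → 𝕜
  | 0 => 1
  | 1 => 2 * z
  | (n + 2) => 2 * z * KK b z (n + 1) + 2 * b * (n + 1) * KK b z n

lemma KK_hasDerivAt {𝕜 : Type*} [NontriviallyNormedField 𝕜] (b z : 𝕜) (n : ℕ) :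
    HasDerivAt (fun w => KK b w (n + 1)) (2 * (n + 1) * KK b z n) z := by
  induction n using Nat.twoStepInduction with
  | zero =>
    simp only [KK, Nat.cast_zero, zero_add]
    simpa using (hasDerivAt_id z).const_mul (2 : 𝕜)
  | one =>
    simp only [KK]
    have h := (((hasDerivAt_id z).const_mul (2 : 𝕜)).mul
      ((hasDerivAt_id z).const_mul (2 : 𝕜))).add_const (2 * b * ((0 : ℕ) + 1) * 1)
    refine h.congr_deriv ?_
    simp
    ring
  | more n ih1 ih2 =>
    have h := (((hasDerivAt_id z).const_mul (2 : 𝕜)).mul ih2).add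
      (ih1.const_mul (2 * b * ((n + 1 : ℕ) + 1)))
    have e : (fun w => KK b w (n + 2 + 1)) = (fun w => 2 * w * KK b w (n + 2) +
      2 * b * ((n + 1 : ℕ) + 1) * KK b w (n + 1)) := by
      funext w; simp only [KK]
    rw [e]
    refine h.congr_deriv ?_
    simp only [KK]
    push_cast
    simp
    ring

lemma KK_hasDerivAt_exp {𝕜 : Type*} [NontriviallyNormedField 𝕜] (b : 𝕜) (hb : b * b = 1)
    (f : 𝕜 → 𝕜) (hf : ∀ z, HasDerivAt f (2 * b * z * f z) z) (n : ℕ) :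
    iteratedDeriv n f = fun z => b ^ n * KK b z n * f z := by
  induction n with
  | zero => funext z; simp [KK]
  | succ n ih =>
    rw [iteratedDeriv_succ, ih]
    funext z
    refine HasDerivAt.deriv ?_
    cases n with
    | zero =>
      simp only [KK]
      refine ((hf z).const_mul (b ^ 0 * 1)).congr_deriv ?_
      ring
    | succ n =>
      refine ((((KK_hasDerivAt b z n).const_mul (b ^ (n + 1))).mul (hf z))).congr_deriv ?_
      simp only [KK]
      have : b ^ (n + 1 + 1) = b ^ n := by rw [pow_succ, pow_succ, mul_assoc, hb, mul_one]
      rw [pow_succ] at this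
      linear_combination (-(b ^ n) * b * 2 * (n + 1) * KK b z n * f z) * hb

lemma physHermite_eq (n : ℕ) (x : ℝ) : physHermite n x = KK (-1) x n := by
  have h := KK_hasDerivAt_exp (-1 : ℝ) (by norm_num) (fun y => Real.exp (-(y ^ 2))) (fun z => by
    refine ((hasDerivAt_id z).pow 2).neg.exp.congr_deriv ?_
    simp; ring) n
  rw [physHermite, h]
  have h1 : Real.exp (x ^ 2) * Real.exp (-(x ^ 2)) = 1 := by rw [← Real.exp_add]; simp
  have h2 : (-1 : ℝ) ^ n * (-1) ^ n = 1 := by rw [← mul_pow]; simp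
  linear_combination ((-1 : ℝ) ^ n * (-1) ^ n * KK (-1) x n) * h1 + KK (-1) x n * h2

lemma KK_gen (b : ℂ) (hb : b * b = 1) (z t : ℂ) :
    HasSum (fun n : ℕ => t ^ n / (n.factorial : ℂ) * KK b z n)
      (Complex.exp (2 * z * t + b * t ^ 2)) := by
  have hd : ∀ w : ℂ, HasDerivAt (fun w : ℂ => Complex.exp (b * w ^ 2))
      (2 * b * w * Complex.exp (b * w ^ 2)) w := fun w => by
    refine (((hasDerivAt_id w).pow 2).const_mul b).cexp.congr_deriv ?_
    simp; ring
  have h := Complex.hasSum_taylorSeries_of_entire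
    (f := fun w : ℂ => Complex.exp (b * w ^ 2)) (fun w => (hd w).differentiableAt) z (z + b * t)
  have h2 := h.mul_right (Complex.exp (-(b * z ^ 2)))
  rw [← Complex.exp_add] at h2
  have e : Complex.exp (b * (z + b * t) ^ 2 + -(b * z ^ 2)) =
      Complex.exp (2 * z * t + b * t ^ 2) := by
    congr 1
    linear_combination (2 * z * t + b * t ^ 2) * hb
  rw [e] at h2
  refine h2.congr_fun ?_
  · intro n
    rw [KK_hasDerivAt_exp b hb _ hd n]
    have h1 : Complex.exp (b * z ^ 2) * Complex.exp (-(b * z ^ 2)) = 1 := by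
      rw [← Complex.exp_add]; simp
    have h3 : b ^ n * b ^ n = 1 := by rw [← mul_pow, hb]; simp
    simp only [smul_eq_mul, add_sub_cancel_left, mul_pow]
    rw [div_eq_mul_inv]
    linear_combination (-(t ^ n * KK b z n * (n.factorial : ℂ)⁻¹)) * h3 -
      (t ^ n * KK b z n * (n.factorial : ℂ)⁻¹ * b ^ n * b ^ n) * h1

lemma KK_ofReal (b z : ℝ) (n : ℕ) : ((KK b z n : ℝ) : ℂ) = KK (b : ℂ) (z : ℂ) n := by
  induction n using Nat.twoStepInduction with
  | zero => simp [KK]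
  | one => simp [KK]
  | more n h1 h2 => simp [KK, h1, h2]

lemma KK_abs (x : ℝ) (n : ℕ) : |KK (-1) x n| ≤ KK 1 |x| n := by
  induction n using Nat.twoStepInduction with
  | zero => simp [KK]
  | one => simp [KK, abs_mul]
  | more n h1 h2 =>
    simp only [KK]
    refine (abs_add_le _ _).trans ?_
    simp only [abs_mul, abs_neg, abs_one, abs_two]
    rw [abs_of_nonneg (by positivity : (0 : ℝ) ≤ (n : ℝ) + 1)]
    gcongr

lemma KK_gen_real (z t : ℝ) :
    HasSum (fun n : ℕ => t ^ n / (n.factorial : ℝ) * KK 1 z n)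
      (Real.exp (2 * z * t + t ^ 2)) := by
  rw [← Complex.hasSum_ofReal]
  have := KK_gen 1 (by simp) z t
  simpa [KK_ofReal] using this

lemma integrable_quad_real (b c d : ℝ) (hb : 0 < b) :
    Integrable (fun u : ℝ => Real.exp (-b * u ^ 2 + c * u + d)) := by
  have h := (integrable_cexp_quadratic (b := (b : ℂ)) (by simpa using hb) c d).norm
  refine h.congr (Filter.Eventually.of_forall fun u => ?_)
  simp only [Complex.norm_exp]
  congr 1
  have : (-(b : ℂ) * u ^ 2 + c * u + d) = ((-b * u ^ 2 + c * u + d : ℝ) : ℂ) := by push_cast; ring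
  rw [this, Complex.ofReal_re]

lemma integrable_quad_abs (b c d : ℝ) (hb : 0 < b) :
    Integrable (fun u : ℝ => Real.exp (-b * u ^ 2 + c * |u| + d)) := by
  refine ((integrable_quad_real b c d hb).add (integrable_quad_real b (-c) d hb)).mono'
    (Continuous.aestronglyMeasurable (by fun_prop)) (Filter.Eventually.of_forall fun u => ?_)
  rw [Real.norm_of_nonneg (Real.exp_pos _).le]
  simp only [Pi.add_apply]
  rcases abs_choice u with h | h <;> rw [h]
  · linarith [Real.exp_pos (-b * u ^ 2 + -c * u + d)]
  · rw [show c * -u = -c * u by ring]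
    linarith [Real.exp_pos (-b * u ^ 2 + c * u + d)]

lemma norm_w_le (y u : ℝ) : ‖(y : ℂ) + Complex.I * u‖ ≤ |y| + |u| := by
  refine (norm_add_le _ _).trans ?_
  simp

lemma integrable_M (y : ℝ) (n : ℕ) :
    Integrable (fun u : ℝ => ((y : ℂ) + Complex.I * u) ^ n * Complex.exp (-(u : ℂ) ^ 2)) := by
  refine ((integrable_quad_abs 1 1 |y| one_pos).const_mul (n.factorial : ℝ)).mono'
    (Continuous.aestronglyMeasurable (by fun_prop)) (Filter.Eventually.of_forall fun u => ?_)
  have e : (-(u : ℂ) ^ 2) = ((-u ^ 2 : ℝ) : ℂ) := by push_cast; ring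
  rw [norm_mul, norm_pow, e, Complex.norm_exp_ofReal]
  have h1 : ‖(y : ℂ) + Complex.I * u‖ ^ n ≤ n.factorial * Real.exp (|y| + |u|) := by
    refine (pow_le_pow_left₀ (norm_nonneg _) (norm_w_le y u) n).trans ?_
    have := Real.pow_div_factorial_le_exp (x := |y| + |u|) (by positivity) n
    rwa [div_le_iff₀' (by positivity)] at this
  refine (mul_le_mul_of_nonneg_right h1 (Real.exp_pos _).le).trans (le_of_eq ?_)
  rw [mul_assoc, ← Real.exp_add]
  congr 2
  ring

lemma hasDerivAt_F (y u : ℝ) (n : ℕ) :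
    HasDerivAt (fun u : ℝ => ((y : ℂ) + Complex.I * u) ^ n * Complex.exp (-(u : ℂ) ^ 2))
      (n * ((y : ℂ) + Complex.I * u) ^ (n - 1) * Complex.I * Complex.exp (-(u : ℂ) ^ 2)
        + ((y : ℂ) + Complex.I * u) ^ n * (-2 * u * Complex.exp (-(u : ℂ) ^ 2))) u := by
  have h0 : HasDerivAt (fun u : ℝ => (u : ℂ)) 1 u := Complex.ofRealCLM.hasDerivAt
  have h1 : HasDerivAt (fun u : ℝ => (y : ℂ) + Complex.I * u) (Complex.I) u := by
    simpa using (h0.const_mul Complex.I).const_add (y : ℂ)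
  have h2 : HasDerivAt (fun u : ℝ => Complex.exp (-(u : ℂ) ^ 2))
      (-2 * u * Complex.exp (-(u : ℂ) ^ 2)) u := by
    refine (h0.pow 2).neg.cexp.congr_deriv ?_
    simp; ring
  exact (h1.pow n).mul h2

lemma M_zero : ∫ u : ℝ, Complex.exp (-(u : ℂ) ^ 2) = (Real.sqrt Real.pi : ℂ) := by
  have h := integral_gaussian 1
  rw [div_one] at h
  rw [← h, ← integral_complex_ofReal]
  congr 1; funext u; push_cast; congr 1; ring

lemma M_eq (y : ℝ) (n : ℕ) :
    ∫ u : ℝ, (2 : ℂ) ^ n * (((y : ℂ) + Complex.I * u) ^ n * Complex.exp (-(u : ℂ) ^ 2))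
      = (Real.sqrt Real.pi : ℂ) * KK (-1) (y : ℂ) n := by
  simp only [integral_const_mul]
  have key : ∀ m : ℕ, ∫ u : ℝ, (Complex.I *
      (m * (((y : ℂ) + Complex.I * u) ^ (m - 1) * Complex.exp (-(u : ℂ) ^ 2))
      + 2 * (((y : ℂ) + Complex.I * u) ^ (m + 1) * Complex.exp (-(u : ℂ) ^ 2))
      - 2 * y * (((y : ℂ) + Complex.I * u) ^ m * Complex.exp (-(u : ℂ) ^ 2)))) = 0 := by
    intro m
    refine integral_eq_zero_of_hasDerivAt_of_integrable (fun u => ?_) ?_ (integrable_M y m)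
    · refine (hasDerivAt_F y u m).congr_deriv ?_
      linear_combination (-2 * u * Complex.exp (-(u : ℂ) ^ 2) *
        ((y : ℂ) + Complex.I * u) ^ m) * Complex.I_mul_I
    · exact ((((integrable_M y (m - 1)).const_mul _).add
        ((integrable_M y (m + 1)).const_mul _)).sub ((integrable_M y m).const_mul _)).const_mul _
  have key2 : ∀ m : ℕ, 
      (m * (∫ u : ℝ, ((y : ℂ) + Complex.I * u) ^ (m - 1) * Complex.exp (-(u : ℂ) ^ 2))
      + 2 * (∫ u : ℝ, ((y : ℂ) + Complex.I * u) ^ (m + 1) * Complex.exp (-(u : ℂ) ^ 2))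
      - 2 * y * (∫ u : ℝ, ((y : ℂ) + Complex.I * u) ^ m * Complex.exp (-(u : ℂ) ^ 2))) = 0 := by
    intro m
    have h := key m
    rw [integral_const_mul, integral_sub, integral_add, integral_const_mul, integral_const_mul,
      integral_const_mul] at h
    · exact (mul_eq_zero.mp h).resolve_left Complex.I_ne_zero
    · exact (integrable_M y (m - 1)).const_mul _
    · exact (integrable_M y (m + 1)).const_mul _
    · exact ((integrable_M y (m - 1)).const_mul _).add ((integrable_M y (m + 1)).const_mul _)
    · exact (integrable_M y m).const_mul _
  induction n using Nat.twoStepInduction with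
  | zero => simpa [KK] using M_zero
  | one =>
    have h := key2 0
    simp only [pow_zero, one_mul, M_zero, Nat.cast_zero, zero_mul, zero_add] at h
    simp only [KK, pow_one] at h ⊢
    linear_combination h
  | more n h1 h2 =>
    have h := key2 (n + 1)
    simp only [KK]
    rw [show n + 1 - 1 = n from rfl] at h
    push_cast at h
    linear_combination 2 ^ (n + 1) * h + 2 * y * h2 - 2 * (n + 1) * h1

lemma main_hasSum (ρ : ℝ) (h0 : 0 ≤ ρ) (h1 : ρ < 1) (x y : ℝ) :
    HasSum (fun n : ℕ => ((ρ ^ n / (2 ^ n * (n.factorial : ℝ)) * KK (-1) x n : ℝ) : ℂ) *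
        ((Real.sqrt Real.pi : ℂ) * KK (-1) (y : ℂ) n))
      (∫ u : ℝ, Complex.exp (2 * x * (ρ * (y + Complex.I * u)) +
        (-1) * (ρ * (y + Complex.I * u)) ^ 2) * Complex.exp (-(u : ℂ) ^ 2)) := by
  simp only [← M_eq, ← integral_const_mul]
  have hs : ∀ u : ℝ, HasSum (fun n : ℕ => (ρ * (|y| + |u|)) ^ n / (n.factorial : ℝ) * KK 1 |x| n *
      Real.exp (-u ^ 2)) (Real.exp (2 * |x| * (ρ * (|y| + |u|)) + (ρ * (|y| + |u|)) ^ 2) *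
      Real.exp (-u ^ 2)) := fun u => (KK_gen_real _ _).mul_right _
  refine hasSum_integral_of_dominated_convergence
    (fun n u => (ρ * (|y| + |u|)) ^ n / (n.factorial : ℝ) * KK 1 |x| n * Real.exp (-u ^ 2))
    (fun n => Continuous.aestronglyMeasurable (by fun_prop))
    (fun n => Filter.Eventually.of_forall fun u => ?_)
    (Filter.Eventually.of_forall fun u => (hs u).summable) ?_
    (Filter.Eventually.of_forall fun u => ?_)
  · have e : (-(u : ℂ) ^ 2) = ((-u ^ 2 : ℝ) : ℂ) := by push_cast; ring
    rw [norm_mul, norm_mul, norm_mul, norm_pow, norm_pow, e, Complex.norm_exp_ofReal,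
      Complex.norm_real, Real.norm_eq_abs, abs_mul, Complex.norm_ofNat,
      abs_of_nonneg (by positivity : 0 ≤ ρ ^ n / (2 ^ n * (n.factorial : ℝ)))]
    calc _ = (ρ * ‖(y : ℂ) + Complex.I * u‖) ^ n / (n.factorial : ℝ) * |KK (-1) x n| *
          Real.exp (-u ^ 2) := by
          rw [mul_pow]; field_simp
      _ ≤ _ := by
          gcongr
          · exact norm_w_le y u
          · exact KK_abs x n
  · simp only [fun u => (hs u).tsum_eq, ← Real.exp_add]
    refine (integrable_quad_abs (1 - ρ ^ 2) (2 * |x| * ρ + 2 * ρ ^ 2 * |y|)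
      (2 * |x| * ρ * |y| + ρ ^ 2 * |y| ^ 2) (by nlinarith)).congr
      (Filter.Eventually.of_forall fun u => ?_)
    simp only
    congr 1
    linear_combination (-ρ ^ 2) * sq_abs u
  · have h := (KK_gen (-1) (by norm_num) (x : ℂ) (ρ * (y + Complex.I * u))).mul_right
      (Complex.exp (-(u : ℂ) ^ 2))
    refine h.congr_fun ?_
    intro n
    push_cast [KK_ofReal]
    rw [mul_pow]
    field_simp

theorem mehler_formula (ρ : ℝ) (hρ : ρ ∈ Set.Ico (0 : ℝ) 1) (x y : ℝ) :
    ∑' n : ℕ, (ρ ^ n / (2 ^ n * (n.factorial : ℝ))) * physHermite n x * physHermite n y *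
        Real.exp (-(x ^ 2 + y ^ 2) / 2)
      = (Real.sqrt (1 - ρ ^ 2))⁻¹ *
        Real.exp ((4 * x * y * ρ - (1 + ρ ^ 2) * (x ^ 2 + y ^ 2)) / (2 * (1 - ρ ^ 2))) := by
  obtain ⟨h0, h1⟩ := hρ
  have hb : 0 < 1 - ρ ^ 2 := by nlinarith
  have hpi : 0 < Real.sqrt Real.pi := Real.sqrt_pos.mpr Real.pi_pos
  have hI : (∫ u : ℝ, Complex.exp (2 * x * (ρ * (y + Complex.I * u)) +
        (-1) * (ρ * (y + Complex.I * u)) ^ 2) * Complex.exp (-(u : ℂ) ^ 2))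
      = ((Real.sqrt Real.pi * (Real.sqrt (1 - ρ ^ 2))⁻¹ *
        Real.exp (2 * x * ρ * y - ρ ^ 2 * y ^ 2 - ρ ^ 2 * (x - ρ * y) ^ 2 / (1 - ρ ^ 2)) : ℝ) : ℂ) := by
    have h := integral_cexp_quadratic (b := ((-(1 - ρ ^ 2) : ℝ) : ℂ))
      (by rw [Complex.ofReal_re]; linarith)
      (2 * Complex.I * ρ * (x - ρ * y)) (2 * x * ρ * y - ρ ^ 2 * y ^ 2)
    have hb' : (1 - (ρ : ℂ) ^ 2) ≠ 0 := by exact_mod_cast hb.ne'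
    calc _ = _ := ?_
      _ = _ := h
      _ = _ := ?_
    · congr 1; funext u
      rw [← Complex.exp_add]
      congr 1
      push_cast
      linear_combination (-(ρ : ℂ) ^ 2 * u ^ 2) * Complex.I_sq
    · have e1 : ((Real.pi : ℂ) / -((-(1 - ρ ^ 2) : ℝ) : ℂ)) ^ (1 / 2 : ℂ)
          = ((Real.sqrt Real.pi * (Real.sqrt (1 - ρ ^ 2))⁻¹ : ℝ) : ℂ) := by
        rw [← div_eq_mul_inv, ← Real.sqrt_div Real.pi_pos.le, Real.sqrt_eq_rpow,
          Complex.ofReal_cpow (by positivity)]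
        push_cast
        simp
      rw [e1]
      push_cast
      congr 2
      have : -(1 - (ρ : ℂ) ^ 2) ≠ 0 := neg_ne_zero.mpr hb'
      field_simp
      linear_combination (4 * (ρ : ℂ) ^ 2 * (x - ρ * y) ^ 2) * Complex.I_sq
  have hs := main_hasSum ρ h0 h1 x y
  rw [hI] at hs
  have hs2 : HasSum (fun n : ℕ => (ρ ^ n / (2 ^ n * (n.factorial : ℝ)) * KK (-1) x n) *
      (Real.sqrt Real.pi * KK (-1) y n)) (Real.sqrt Real.pi * (Real.sqrt (1 - ρ ^ 2))⁻¹ *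
        Real.exp (2 * x * ρ * y - ρ ^ 2 * y ^ 2 - ρ ^ 2 * (x - ρ * y) ^ 2 / (1 - ρ ^ 2))) := by
    rw [← Complex.hasSum_ofReal]
    refine hs.congr_fun fun n => ?_
    push_cast [KK_ofReal]
    rfl
  have hs3 := (hs2.mul_left (Real.sqrt Real.pi)⁻¹).mul_right (Real.exp (-(x ^ 2 + y ^ 2) / 2))
  have hs4 := hs3.tsum_eq
  simp only [physHermite_eq]
  calc _ = _ := ?_
    _ = _ := hs4
    _ = _ := ?_
  · congr 1; funext n
    field_simp
  · rw [mul_assoc (Real.sqrt Real.pi), inv_mul_cancel_left₀ hpi.ne', mul_assoc, ← Real.exp_add]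
    congr 2
    field_simp
    ring
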